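/- arXiv:cs/0612088 — 7 statements merged into one kernel-verified Lean document; each statement's English description precedes it below -/
import Mathlib

section
/- Let n ≥ 1 and 0 < α < 1 be real numbers, let σ > 0, and let N : ℝ → ℝ be a nonincreasing function. Let A ⊆ [0,∞) be a set such that for every t ∈ A one has 1 ≤ N(t) ≤ n and N(t + σ) ≤ α · N(t). Then the Lebesgue outer measure of A is at most σ · (1 + (Real.log n) / (Real.log (1/α))). -/
open MeasureTheory

/-- If `N` is at least `1` and at most `n` on a set `A` that is bounded below, decays by the factor
`α` over a shift by `σ` from each point of `A`, and `n * α ^ k < 1`, then `A` has measure at most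
`k * σ`. -/
lemma volume_le_of_mul_pow_lt_one {α σ : ℝ} (hα : 0 ≤ α) (hσ : 0 ≤ σ) {N : ℝ → ℝ}
    (hN : Antitone N) {k : ℕ} {n : ℝ} {A : Set ℝ} (hk : n * α ^ k < 1) (hA : BddBelow A)
    (hbound : ∀ t ∈ A, 1 ≤ N t ∧ N t ≤ n) (hdecay : ∀ t ∈ A, N (t + σ) ≤ α * N t) :
    volume A ≤ ENNReal.ofReal (k * σ) := by
  induction k generalizing n A with
  | zero =>
    have hempty : A = ∅ := Set.eq_empty_of_forall_notMem fun t ht => by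
      have := hbound t ht
      simp only [pow_zero, mul_one] at hk
      linarith
    simp [hempty]
  | succ k ih =>
    rcases A.eq_empty_or_nonempty with rfl | hne
    · simp
    set s := sInf A
    have htail : volume (A ∩ Set.Ioi (s + σ)) ≤ ENNReal.ofReal (k * σ) := by
      refine ih (n := α * n) (by rw [pow_succ] at hk; linarith) (hA.mono Set.inter_subset_left)
        (fun t ht => ⟨(hbound t ht.1).1, ?_⟩) fun t ht => hdecay t ht.1
      have hst : s + σ < t := ht.2
      obtain ⟨a, ha, hat⟩ := exists_lt_of_csInf_lt hne (show sInf A < t - σ by linarith)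
      calc N t ≤ N (a + σ) := hN (by linarith)
        _ ≤ α * N a := hdecay a ha
        _ ≤ α * n := mul_le_mul_of_nonneg_left (hbound a ha).2 hα
    have hcover : A ⊆ Set.Icc s (s + σ) ∪ A ∩ Set.Ioi (s + σ) := fun t ht =>
      (le_or_gt t (s + σ)).imp (fun h => ⟨csInf_le hA ht, h⟩) fun h => ⟨ht, h⟩
    calc volume A ≤ volume (Set.Icc s (s + σ)) + volume (A ∩ Set.Ioi (s + σ)) :=
          (measure_mono hcover).trans (measure_union_le _ _)
      _ ≤ ENNReal.ofReal σ + ENNReal.ofReal (k * σ) := by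
          gcongr
          simp
      _ = ENNReal.ofReal ((k + 1 : ℕ) * σ) := by
          rw [← ENNReal.ofReal_add hσ (by positivity)]
          push_cast
          ring_nf

/-- Covering argument: if at every point `t` of `A ⊆ [0,∞)` the nonincreasing function `N`
satisfies `1 ≤ N t ≤ n` and decays geometrically over a shift by `σ`
(`N (t + σ) ≤ α * N t`), then the Lebesgue outer measure of `A` is at most
`σ * (1 + log n / log (1/α))`. -/
theorem outer_measure_of_geometric_decay
    (n α σ : ℝ) (hn : 1 ≤ n) (hα0 : 0 < α) (hα1 : α < 1) (hσ : 0 < σ)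
    (N : ℝ → ℝ) (hN : Antitone N)
    (A : Set ℝ) (hA : A ⊆ Set.Ici (0 : ℝ))
    (hbound : ∀ t ∈ A, 1 ≤ N t ∧ N t ≤ n)
    (hdecay : ∀ t ∈ A, N (t + σ) ≤ α * N t) :
    volume A ≤ ENNReal.ofReal (σ * (1 + Real.log n / Real.log (1 / α))) := by
  have hlog : 0 < Real.log (1 / α) := Real.log_pos (one_lt_one_div hα0 hα1)
  set x := Real.log n / Real.log (1 / α) with hx
  have hx0 : 0 ≤ x := div_nonneg (Real.log_nonneg hn) hlog.le
  have hk : n * α ^ (⌊x⌋₊ + 1) < 1 := by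
    have hlt : x < (⌊x⌋₊ + 1 : ℕ) := by exact_mod_cast Nat.lt_floor_add_one x
    generalize ⌊x⌋₊ + 1 = m at hlt ⊢
    rw [hx, div_lt_iff₀ hlog, ← Real.log_pow,
      Real.log_lt_log_iff (by linarith) (by positivity), one_div, inv_pow] at hlt
    rwa [← lt_div_iff₀ (by positivity), one_div]
  refine (volume_le_of_mul_pow_lt_one hα0.le hσ.le hN hk ⟨0, hA⟩ hbound hdecay).trans ?_
  refine ENNReal.ofReal_le_ofReal ?_
  have hfloor : (⌊x⌋₊ : ℝ) ≤ x := Nat.floor_le hx0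
  push_cast
  nlinarith
end

section
/- Consider a Par-Seq instance of n ≥ 1 jobs executed by Equi on one processor, encoded by reals a_j and c_j as in the context. Then for every real α with 0 < α < 1, the makespan T = max_j c_j satisfies T ≤ (1/α) · (∑_{j=1}^n P_j) + (1 + (Real.log n)/(Real.log (1/α))) · max_{j=1..n} Q_j. -/
open MeasureTheory

/-- Integrating the `q`-step decrease of an antitone function telescopes to two boundary
windows of length `q`, so it is controlled by an upper and a lower bound of the function. -/
theorem Antitone.integral_sub_shift_le {M : ℝ → ℝ} (hM : Antitone M) {u l q : ℝ} (hq : 0 ≤ q)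
    (hu : ∀ t, M t ≤ u) (hl : ∀ t, l ≤ M t) (T : ℝ) :
    (∫ t in (0:ℝ)..T, (M t - M (t + q))) ≤ q * (u - l) := by
  have hint : ∀ x y, IntervalIntegrable M volume x y := fun x y => hM.intervalIntegrable
  have hshift : Antitone fun t => M (t + q) := fun x y hxy => hM (by linarith)
  rw [intervalIntegral.integral_sub (hint _ _) hshift.intervalIntegrable,
    intervalIntegral.integral_comp_add_right, zero_add,
    intervalIntegral.integral_interval_sub_interval_comm (hint _ _) (hint _ _) (hint _ _)]
  have hupper : (∫ t in (0:ℝ)..q, M t) ≤ ∫ _ in (0:ℝ)..q, u :=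
    intervalIntegral.integral_mono hq (hint _ _) intervalIntegrable_const fun t => hu t
  have hlower : (∫ _ in T..(T + q), l) ≤ ∫ t in T..(T + q), M t :=
    intervalIntegral.integral_mono (by linarith) intervalIntegrable_const (hint _ _)
      fun t => hl t
  simp only [intervalIntegral.integral_const, smul_eq_mul] at hupper hlower
  linarith

/-- Makespan bound for `Equi` on a Par-Seq instance of `n ≥ 1` jobs on one processor.
Job `j` has a fully parallel phase of work `P j ≥ 0` followed by a sequential phase of
work `Q j ≥ 0`; `a j` is the end of its parallel phase, `c j = a j + Q j` its completion
time, `N t = #{j : t < c j}` the number of uncompleted jobs at time `t`, and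
`∫_0^{a j} (N t)⁻¹ dt = P j`.  Then for every `0 < α < 1`, the makespan `T = max_j c j`
satisfies `T ≤ (1/α) * ∑ P j + (1 + log n / log (1/α)) * max_j Q j`. -/
theorem equi_makespan_bound
    (n : ℕ) (hn : 1 ≤ n)
    (P Q a c : Fin n → ℝ)
    (hP : ∀ j, 0 ≤ P j) (hQ : ∀ j, 0 ≤ Q j) (ha : ∀ j, 0 ≤ a j)
    (hc : ∀ j, c j = a j + Q j)
    (N : ℝ → ℝ)
    (hN : ∀ t, N t = ((Finset.univ.filter fun j => t < c j).card : ℝ))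
    (hwork : ∀ j, (∫ t in (0:ℝ)..(a j), (N t)⁻¹) = P j)
    (T : ℝ)
    (hT : T = Finset.univ.sup' ⟨⟨0, hn⟩, Finset.mem_univ _⟩ c)
    (α : ℝ) (hα0 : 0 < α) (hα1 : α < 1) :
    T ≤ (1 / α) * (∑ j, P j) +
      (1 + Real.log n / Real.log (1 / α)) *
        Finset.univ.sup' ⟨⟨0, hn⟩, Finset.mem_univ _⟩ Q := by
  set q := Finset.univ.sup' ⟨⟨0, hn⟩, Finset.mem_univ _⟩ Q
  have hQq : ∀ j, Q j ≤ q := fun j => Finset.le_sup' Q (Finset.mem_univ j)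
  have hq0 : 0 ≤ q := (hQ ⟨0, hn⟩).trans (hQq _)
  have hcT : ∀ j, c j ≤ T := fun j => hT ▸ Finset.le_sup' c (Finset.mem_univ j)
  have haT : ∀ j, a j ≤ T := fun j => by linarith [hcT j, hc j, hQ j]
  have hT0 : 0 ≤ T := (ha ⟨0, hn⟩).trans (haT _)
  have hn1 : (1 : ℝ) ≤ n := by exact_mod_cast hn
  have hNanti : Antitone N := by
    intro x y hxy
    rw [hN, hN]
    exact_mod_cast Finset.card_le_card
      (Finset.monotone_filter_right _ fun j _ hj => hxy.trans_lt hj)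
  have hN0 : ∀ t, 0 ≤ N t := fun t => by rw [hN]; positivity
  have hNn : ∀ t, N t ≤ n := fun t => by
    rw [hN]
    exact_mod_cast (Finset.card_le_univ _).trans_eq (Fintype.card_fin n)
  have hN1 : ∀ t, t < T → 1 ≤ N t := by
    intro t ht
    obtain ⟨j, -, hj⟩ := (Finset.lt_sup'_iff _).mp (hT ▸ ht)
    rw [hN]
    exact_mod_cast Finset.card_pos.mpr ⟨j, by simpa using hj⟩
  have hinv1 : ∀ t, (N t)⁻¹ ≤ 1 := by
    intro t
    rw [hN]
    exact Nat.cast_inv_le_one _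
  -- the logarithmic potential, truncated so that it is finite once all jobs are completed
  let M : ℝ → ℝ := fun t => Real.log (max (N t) α) / Real.log (1 / α)
  have hL : 0 < Real.log (1 / α) := Real.log_pos (by rw [lt_div_iff₀ hα0]; linarith)
  have hpos : ∀ t, 0 < max (N t) α := fun t => lt_max_of_lt_right hα0
  have hManti : Antitone M := fun x y hxy =>
    div_le_div_of_nonneg_right
      (Real.log_le_log (hpos y) (max_le_max_right α (hNanti hxy))) hL.le
  have hMu : ∀ t, M t ≤ Real.log n / Real.log (1 / α) := fun t =>
    div_le_div_of_nonneg_right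
      (Real.log_le_log (hpos t) (max_le (hNn t) (hα1.le.trans hn1))) hL.le
  have hMl : ∀ t, -1 ≤ M t := by
    intro t
    rw [le_div_iff₀ hL, one_div, Real.log_inv]
    linarith [Real.log_le_log hα0 (le_max_right (N t) α)]
  have hMint := hManti.integral_sub_shift_le hq0 hMu hMl T
  let F : Fin n → ℝ → ℝ := fun j => Set.indicator {t | t ≤ a j} fun t => (N t)⁻¹
  have hFint : ∀ j, IntervalIntegrable (F j) volume 0 T := by
    intro j
    refine (intervalIntegrable_const (c := (1 : ℝ))).mono_fun'
      (hNanti.measurable.inv.indicator measurableSet_Iic).aestronglyMeasurable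
      (Filter.Eventually.of_forall fun t => ?_)
    refine (norm_indicator_le_norm_self _ _).trans ?_
    rw [Real.norm_of_nonneg (inv_nonneg.mpr (hN0 t))]
    exact hinv1 t
  have hF : ∀ j, (∫ t in (0:ℝ)..T, F j t) = P j := fun j =>
    (intervalIntegral.integral_indicator ⟨ha j, haT j⟩).trans (hwork j)
  have hsumint : IntervalIntegrable (fun t => (1 / α) * ∑ j, F j t) volume 0 T := by
    have := IntervalIntegrable.sum Finset.univ (fun j _ => hFint j)
    simpa [Finset.sum_apply] using this.const_mul (1 / α)
  have hshift : Antitone fun t => M (t + q) := fun x y hxy => hManti (by linarith)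
  have hdiffint : IntervalIntegrable (fun t => M t - M (t + q)) volume 0 T :=
    hManti.intervalIntegrable.sub hshift.intervalIntegrable
  have hpt : ∀ t ∈ Set.Ioo 0 T, (1 : ℝ) ≤ (1 / α) * ∑ j, F j t + (M t - M (t + q)) := by
    intro t ht
    have hNt := hN1 t ht.2
    have hA : ∑ j, F j t = ((Finset.univ.filter fun j => t ≤ a j).card : ℝ) * (N t)⁻¹ := by
      simp [F, Set.indicator_apply, ← Finset.sum_filter]
    set A : ℝ := ((Finset.univ.filter fun j => t ≤ a j).card : ℝ) with hAdef
    have hNA : N (t + q) ≤ A := by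
      rw [hN, hAdef, Nat.cast_le]
      refine Finset.card_le_card (Finset.monotone_filter_right _ fun j _ hj => ?_)
      linarith [hc j, hQq j]
    have hdec : M (t + q) ≤ M t := hManti (by linarith)
    rw [hA]
    by_cases hgood : α * N t ≤ A
    · have : 1 ≤ 1 / α * (A * (N t)⁻¹) := by
        rw [← div_eq_mul_inv, div_mul_div_comm, one_mul, le_div_iff₀ (by positivity)]
        linarith
      linarith
    · have hA0 : 0 ≤ 1 / α * (A * (N t)⁻¹) := by
        have := hN0 t
        positivity
      have hdrop : max (N (t + q)) α ≤ α * N t :=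
        max_le (by linarith) (le_mul_of_one_le_right hα0.le hNt)
      have hlog := Real.log_le_log (hpos (t + q)) hdrop
      rw [Real.log_mul hα0.ne' (by linarith)] at hlog
      have hlogN := Real.log_le_log (by linarith) (le_max_left (N t) α)
      have : 1 ≤ M t - M (t + q) := by
        rw [← sub_div, le_div_iff₀ hL, one_div, Real.log_inv]
        linarith
      linarith
  have hmono := intervalIntegral.integral_mono_on_of_le_Ioo hT0
    (intervalIntegrable_const (c := (1 : ℝ))) (hsumint.add hdiffint) hpt
  rw [intervalIntegral.integral_add hsumint hdiffint, intervalIntegral.integral_const_mul,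
    intervalIntegral.integral_finsetSum fun j _ => hFint j] at hmono
  simp only [hF, intervalIntegral.integral_const, smul_eq_mul, mul_one, sub_zero] at hmono
  linarith
end

section
/- Let ρ : ℝ → [0,∞) be nondecreasing and locally integrable, let w ≥ 0, and let t₀ ≤ t₁ be reals. Suppose the sets {x ≥ t₀ : ∫_{t₀}^x ρ(u) du ≥ w} and {x ≥ t₁ : ∫_{t₁}^x ρ(u) du ≥ w} are nonempty, and let u and v be their respective infima. Then v − t₁ ≤ u − t₀. -/
open MeasureTheory

/-- The integral of a monotone function over an interval does not decrease when the interval is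
translated to the right. -/
theorem Monotone.intervalIntegral_le_intervalIntegral_add_right {f : ℝ → ℝ} (hf : Monotone f)
    {a b d : ℝ} (hab : a ≤ b) (hd : 0 ≤ d) :
    ∫ u in a..b, f u ≤ ∫ u in (a + d)..(b + d), f u := by
  rw [← intervalIntegral.integral_comp_add_right f d]
  have hshift : Monotone fun u => f (u + d) := fun x y hxy => hf (by linarith)
  exact intervalIntegral.integral_mono_on hab hf.intervalIntegrable hshift.intervalIntegrable
    fun x _ => hf (by linarith)

/-- Monotone-shift lemma: if `ρ` is nondecreasing, nonnegative and locally integrable,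
then performing a given amount `w ≥ 0` of fully parallel work under allocation `ρ`
starting at a later time `t₁ ≥ t₀` takes no longer than starting at `t₀`. -/
theorem monotone_shift_lemma
    (ρ : ℝ → ℝ) (hmono : Monotone ρ) (hρ0 : ∀ t, 0 ≤ ρ t)
    (hloc : LocallyIntegrable ρ volume)
    (w : ℝ) (hw : 0 ≤ w)
    (t₀ t₁ : ℝ) (ht : t₀ ≤ t₁)
    (h0 : {x : ℝ | t₀ ≤ x ∧ w ≤ ∫ u in t₀..x, ρ u}.Nonempty)
    (h1 : {x : ℝ | t₁ ≤ x ∧ w ≤ ∫ u in t₁..x, ρ u}.Nonempty) :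
    sInf {x : ℝ | t₁ ≤ x ∧ w ≤ ∫ u in t₁..x, ρ u} - t₁ ≤
      sInf {x : ℝ | t₀ ≤ x ∧ w ≤ ∫ u in t₀..x, ρ u} - t₀ := by
  suffices h : sInf {x : ℝ | t₁ ≤ x ∧ w ≤ ∫ u in t₁..x, ρ u} - (t₁ - t₀) ≤
      sInf {x : ℝ | t₀ ≤ x ∧ w ≤ ∫ u in t₀..x, ρ u} by linarith
  refine le_csInf h0 fun x hx => ?_
  have hshift := hmono.intervalIntegral_le_intervalIntegral_add_right hx.1 (sub_nonneg.2 ht)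
  rw [add_sub_cancel] at hshift
  have hle := csInf_le (⟨t₁, fun y hy => hy.1⟩ : BddBelow {x : ℝ | t₁ ≤ x ∧ w ≤ ∫ u in t₁..x, ρ u})
    (⟨by linarith [hx.1], hx.2.trans hshift⟩ : t₁ ≤ x + (t₁ - t₀) ∧ _)
  linarith
end

section
/- Let ρ : ℝ → [0,∞) be nondecreasing and locally integrable, and assume that for every t and every w ≥ 0 there exists x ≥ t with ∫_t^x ρ(u) du ≥ w. For a finite list L of phases, each phase being either 'seq w' (sequential work w ≥ 0, progressing at rate 1 regardless of allocation) or 'par w' (fully parallel work w ≥ 0, progressing at rate ρ(t)), define the completion time C(t, L) recursively by: C(t, []) = t; C(t, (seq w)::L') = C(t + w, L'); C(t, (par w)::L') = C(τ, L') where τ = inf{x ≥ t : ∫_t^x ρ(u) du ≥ w}. Let W_par be the sum of the works of the parallel phases of L and W_seq the sum of the works of the sequential phases of L. Then C(0, L) ≤ C(0, [par W_par, seq W_seq]). -/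
open MeasureTheory

/-- A phase of a `(Par-Seq)*` job: either a sequential work `w` (progressing at rate `1`
regardless of allocation) or a fully parallel work `w` (progressing at rate `ρ t`). -/
inductive Phase where
  | seq (w : ℝ) : Phase
  | par (w : ℝ) : Phase

/-- The work of a phase. -/
def Phase.work : Phase → ℝ
  | .seq w => w
  | .par w => w

/-- Completion time of a list of phases started at time `t` under allocation `ρ`:
a sequential phase of work `w` finishes `w` time units later, and a parallel phase of
work `w` started at time `t` finishes at the first time `x ≥ t` with `∫_t^x ρ ≥ w`. -/
noncomputable def completionTime (ρ : ℝ → ℝ) : ℝ → List Phase → ℝ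
  | t, [] => t
  | t, .seq w :: L => completionTime ρ (t + w) L
  | t, .par w :: L =>
      completionTime ρ (sInf {x : ℝ | t ≤ x ∧ w ≤ ∫ u in t..x, ρ u}) L

/-- Total parallel work of a list of phases. -/
def parWork : List Phase → ℝ
  | [] => 0
  | Phase.par w :: L => w + parWork L
  | Phase.seq _ :: L => parWork L

/-- Total sequential work of a list of phases. -/
def seqWork : List Phase → ℝ
  | [] => 0
  | Phase.par _ :: L => seqWork L
  | Phase.seq w :: L => w + seqWork L

/-- The finishing time of parallel work `w` started at time `t` under allocation `ρ`. -/
noncomputable def parFinish (ρ : ℝ → ℝ) (t w : ℝ) : ℝ :=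
  sInf {x : ℝ | t ≤ x ∧ w ≤ ∫ u in t..x, ρ u}

lemma parFinish_le {ρ : ℝ → ℝ} {t w x : ℝ} (htx : t ≤ x) (hw : w ≤ ∫ u in t..x, ρ u) :
    parFinish ρ t w ≤ x :=
  csInf_le ⟨t, fun _ hy => hy.1⟩ ⟨htx, hw⟩

lemma continuous_integral_of_monotone {ρ : ℝ → ℝ} (hmono : Monotone ρ) (t : ℝ) :
    Continuous fun x => ∫ u in t..x, ρ u :=
  intervalIntegral.continuous_primitive (fun _ _ => hmono.intervalIntegrable) t

/-- The infimum defining the finishing time is attained. -/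
lemma parFinish_mem {ρ : ℝ → ℝ} (hmono : Monotone ρ) {t w : ℝ}
    (hfeas : ∃ x : ℝ, t ≤ x ∧ w ≤ ∫ u in t..x, ρ u) :
    t ≤ parFinish ρ t w ∧ w ≤ ∫ u in t..parFinish ρ t w, ρ u := by
  have hclosed : IsClosed {x : ℝ | t ≤ x ∧ w ≤ ∫ u in t..x, ρ u} :=
    isClosed_Ici.inter
      (isClosed_le continuous_const (continuous_integral_of_monotone hmono t))
  exact hclosed.csInf_mem hfeas ⟨t, fun _ hy => hy.1⟩

/-- At the finishing time no more than the required work has been done. -/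
lemma integral_parFinish_le {ρ : ℝ → ℝ} (hmono : Monotone ρ) (hρ0 : ∀ t, 0 ≤ ρ t) {t w : ℝ}
    (hw : 0 ≤ w) (hfeas : ∃ x : ℝ, t ≤ x ∧ w ≤ ∫ u in t..x, ρ u) :
    ∫ u in t..parFinish ρ t w, ρ u ≤ w := by
  obtain ⟨x, htx, hx⟩ := hfeas
  obtain ⟨y, ⟨hty, -⟩, hy⟩ : w ∈ (fun x => ∫ u in t..x, ρ u) '' Set.Icc t x :=
    intermediate_value_Icc htx (continuous_integral_of_monotone hmono t).continuousOn
      ⟨by simpa using hw, hx⟩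
  have hle : parFinish ρ t w ≤ y := parFinish_le hty hy.ge
  have hadd := intervalIntegral.integral_add_adjacent_intervals
    (hmono.intervalIntegrable (μ := volume) (a := t) (b := parFinish ρ t w))
    (hmono.intervalIntegrable (b := y))
  have hnonneg : 0 ≤ ∫ u in parFinish ρ t w..y, ρ u :=
    intervalIntegral.integral_nonneg hle fun u _ => hρ0 u
  have hy' : ∫ u in t..y, ρ u = w := hy
  linarith

/-- Delaying the start by `s` delays the finishing time by at most `s`. -/
lemma parFinish_add_le {ρ : ℝ → ℝ} (hmono : Monotone ρ) {t w s : ℝ} (hs : 0 ≤ s)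
    (hfeas : ∃ x : ℝ, t ≤ x ∧ w ≤ ∫ u in t..x, ρ u) :
    parFinish ρ (t + s) w ≤ parFinish ρ t w + s := by
  obtain ⟨hle, hw⟩ := parFinish_mem hmono hfeas
  refine parFinish_le (by linarith) (hw.trans ?_)
  rw [← intervalIntegral.integral_comp_add_right]
  have hshift : Monotone fun u => ρ (u + s) := fun a b hab => hmono (by linarith)
  exact intervalIntegral.integral_mono_on hle hmono.intervalIntegrable
    hshift.intervalIntegrable fun u _ => hmono (by linarith)

/-- Doing parallel work `v` and then `w` takes no longer than doing `v + w` at once. -/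
lemma parFinish_parFinish_le {ρ : ℝ → ℝ} (hmono : Monotone ρ) (hρ0 : ∀ t, 0 ≤ ρ t)
    {t v w : ℝ} (hv : 0 ≤ v) (hw : 0 ≤ w)
    (hfeas : ∃ x : ℝ, t ≤ x ∧ v + w ≤ ∫ u in t..x, ρ u) :
    parFinish ρ (parFinish ρ t v) w ≤ parFinish ρ t (v + w) := by
  obtain ⟨hle, hvw⟩ := parFinish_mem hmono hfeas
  have hv' : v ≤ ∫ u in t..parFinish ρ t (v + w), ρ u := by linarith
  refine parFinish_le (parFinish_le hle hv') ?_
  have hdone := integral_parFinish_le hmono hρ0 hv ⟨_, hle, hv'⟩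
  have hadd := intervalIntegral.integral_add_adjacent_intervals
    (hmono.intervalIntegrable (μ := volume) (a := t) (b := parFinish ρ t v))
    (hmono.intervalIntegrable (b := parFinish ρ t (v + w)))
  linarith

lemma parWork_nonneg : ∀ {L : List Phase}, (∀ p ∈ L, 0 ≤ p.work) → 0 ≤ parWork L
  | [], _ => le_rfl
  | .par _ :: _, hL =>
    add_nonneg (hL _ List.mem_cons_self)
      (parWork_nonneg fun p hp => hL p (List.mem_cons_of_mem _ hp))
  | .seq _ :: L, hL => parWork_nonneg (L := L) fun p hp => hL p (List.mem_cons_of_mem _ hp)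

lemma completionTime_le_parFinish_add {ρ : ℝ → ℝ} (hmono : Monotone ρ) (hρ0 : ∀ t, 0 ≤ ρ t)
    (hfeas : ∀ t : ℝ, ∀ w : ℝ, 0 ≤ w → ∃ x : ℝ, t ≤ x ∧ w ≤ ∫ u in t..x, ρ u)
    (L : List Phase) (hL : ∀ p ∈ L, 0 ≤ p.work) (t : ℝ) :
    completionTime ρ t L ≤ parFinish ρ t (parWork L) + seqWork L := by
  induction L generalizing t with
  | nil => simpa [completionTime, parWork, seqWork] using
      (parFinish_mem hmono (hfeas t 0 le_rfl)).1
  | cons p L ih =>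
    have hL' : ∀ q ∈ L, 0 ≤ q.work := fun q hq => hL q (List.mem_cons_of_mem _ hq)
    have hP := parWork_nonneg hL'
    have hp := hL p List.mem_cons_self
    cases p with
    | seq w =>
      have hdelay := parFinish_add_le hmono (s := w) hp (hfeas t _ hP)
      have htail := ih hL' (t + w)
      simp only [completionTime, parWork, seqWork]
      linarith
    | par w =>
      have hmerge := parFinish_parFinish_le hmono hρ0 (v := w) hp hP
        (hfeas t _ (add_nonneg hp hP))
      exact (ih hL' (parFinish ρ t w)).trans (add_le_add_left hmerge _)

/-- Under a nondecreasing allocation `ρ` (as is each job's allotment under `Equi` when all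
jobs arrive at time `0`), replacing a `(Par-Seq)*` job by the job that does all its
parallel work first and all its sequential work last can only delay its completion. -/
theorem completion_le_parseq
    (ρ : ℝ → ℝ) (hmono : Monotone ρ) (hρ0 : ∀ t, 0 ≤ ρ t)
    (hloc : LocallyIntegrable ρ volume)
    (hfeas : ∀ t : ℝ, ∀ w : ℝ, 0 ≤ w → ∃ x : ℝ, t ≤ x ∧ w ≤ ∫ u in t..x, ρ u)
    (L : List Phase) (hL : ∀ p ∈ L, 0 ≤ p.work) :
    completionTime ρ 0 L ≤
      completionTime ρ 0 [Phase.par (parWork L), Phase.seq (seqWork L)] := by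
  exact completionTime_le_parFinish_add hmono hρ0 hfeas L hL 0
end

section
/- Consider one set of n₁ jobs inside an Equi∘Equi execution, encoded as in the context, and let 0 < α < 1. Let K̄ = { t ∈ [0, T) : #{j : a_j ≤ t < c_j} < (1−α)·N₁(t) } (the set of times at which the fraction of uncompleted jobs of the set that are in their sequential phase is less than 1−α). Then ∫_{K̄} N(t)^{-1} dt ≤ (1/α) · ∑_{j=1}^{n₁} P_j. -/
open MeasureTheory

/-- Counting, in a finite family of measurable conditions on `t`, those that hold at `t` is a
measurable function of `t`. -/
theorem measurable_card_filter {X ι : Type*} [MeasurableSpace X] [Fintype ι] (p : ι → X → Prop)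
    [∀ i x, Decidable (p i x)] (hp : ∀ i, MeasurableSet {x | p i x}) :
    Measurable fun x => ((Finset.univ.filter fun i => p i x).card : ℝ) := by
  simp only [Finset.card_filter, Nat.cast_sum, Nat.cast_ite, Nat.cast_one, Nat.cast_zero]
  exact Finset.measurable_fun_sum _ fun i _ =>
    Measurable.ite (hp i) measurable_const measurable_const

/-- The uncompleted jobs are those in their parallel phase plus those in their sequential phase. -/
theorem card_parallel_add_card_sequential {ι : Type*} [Fintype ι] {a c : ι → ℝ}
    (hac : ∀ j, a j ≤ c j) (t : ℝ) :
    (Finset.univ.filter fun j => t < a j).card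
        + (Finset.univ.filter fun j => a j ≤ t ∧ t < c j).card
      = (Finset.univ.filter fun j => t < c j).card := by
  classical
  rw [← Finset.card_union_of_disjoint]
  · congr 1
    ext j
    have := hac j
    simp only [Finset.mem_union, Finset.mem_filter, Finset.mem_univ, true_and]
    grind
  · rw [Finset.disjoint_filter]
    intro j _ hpar hseq
    exact absurd hpar (not_lt.mpr hseq.1)

/-- Parallel-work bound in the key lemma reducing the setflowtime analysis of `Equi∘Equi`
to the flowtime analysis of `Equi`.  One set of `n₁` Par-Seq jobs inside an `Equi∘Equi`
execution: job `j` has parallel work `P j ≥ 0` then sequential work `Q j ≥ 0`; `N t ≥ 1`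
is the number of uncompleted sets at time `t`; `N₁ t = #{j : t < c j}`; the end of job
`j`'s parallel phase is `a j ≥ 0`, its completion time `c j = a j + Q j`, and
`∫_0^{a j} (N t · N₁ t)⁻¹ dt = P j`.  On the set `K̄` of times `t ∈ [0, T)` at which the
fraction of uncompleted jobs of the set in their sequential phase is `< 1 − α`, one has
`∫_{K̄} (N t)⁻¹ dt ≤ (1/α) · ∑_j P j`. -/
theorem equi_equi_parallel_bound
    (n₁ : ℕ) (hn₁ : 1 ≤ n₁)
    (P Q a c : Fin n₁ → ℝ) (N : ℝ → ℝ)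
    (hNmeas : Measurable N) (hN1 : ∀ t, 1 ≤ N t)
    (hP : ∀ j, 0 ≤ P j) (hQ : ∀ j, 0 ≤ Q j) (ha : ∀ j, 0 ≤ a j)
    (hc : ∀ j, c j = a j + Q j)
    (N₁ : ℝ → ℝ)
    (hN₁ : ∀ t, N₁ t = ((Finset.univ.filter fun j => t < c j).card : ℝ))
    (hwork : ∀ j, (∫ t in (0:ℝ)..(a j), (N t * N₁ t)⁻¹) = P j)
    (T : ℝ) (hT : T = Finset.univ.sup' ⟨⟨0, hn₁⟩, Finset.mem_univ _⟩ c)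
    (α : ℝ) (hα0 : 0 < α) (hα1 : α < 1)
    (Kbar : Set ℝ)
    (hKbar : Kbar = {t : ℝ | t ∈ Set.Ico 0 T ∧
      ((Finset.univ.filter fun j => a j ≤ t ∧ t < c j).card : ℝ) < (1 - α) * N₁ t}) :
    (∫ t in Kbar, (N t)⁻¹) ≤ (1 / α) * ∑ j, P j := by
  have hN₁meas : Measurable N₁ := by
    rw [funext hN₁]
    exact measurable_card_filter _ fun j => measurableSet_Iio
  have hKmeas : MeasurableSet Kbar := by
    rw [hKbar]
    exact measurableSet_Ico.inter <| measurableSet_lt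
      (measurable_card_filter (fun j t => a j ≤ t ∧ t < c j) fun j => measurableSet_Ico)
      (hN₁meas.const_mul _)
  set g : ℝ → ℝ := fun t => (N t * N₁ t)⁻¹ with hg
  have hN₁nonneg : ∀ t, 0 ≤ N₁ t := fun t => by rw [hN₁]; positivity
  have hgnonneg : ∀ t, 0 ≤ g t := fun t =>
    inv_nonneg.mpr (mul_nonneg (zero_le_one.trans (hN1 t)) (hN₁nonneg t))
  have hgle : ∀ t, g t ≤ 1 := by
    intro t
    rcases Nat.eq_zero_or_pos (Finset.univ.filter fun j => t < c j).card with h | h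
    · simp [hg, hN₁, h]
    · have h1 : 1 ≤ N₁ t := by rw [hN₁]; exact_mod_cast h
      exact inv_le_one_of_one_le₀ (one_le_mul_of_one_le_of_one_le (hN1 t) h1)
  have hint : ∀ j, Integrable ((Set.Ico 0 (a j)).indicator g) := by
    intro j
    rw [integrable_indicator_iff measurableSet_Ico]
    refine Measure.integrableOn_of_bounded (M := 1) (by simp)
      (hNmeas.mul hN₁meas).inv.aestronglyMeasurable (Filter.Eventually.of_forall fun t => ?_)
    rw [Real.norm_of_nonneg (hgnonneg t)]
    exact hgle t
  have hPint : ∀ j, ∫ t, (Set.Ico 0 (a j)).indicator g t = P j := by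
    intro j
    rw [integral_indicator measurableSet_Ico, integral_Ico_eq_integral_Ioc,
      ← intervalIntegral.integral_of_le (ha j), hwork j]
  have hsum : (1 / α) * ∑ j, P j
      = ∫ t, (1 / α) * ∑ j, (Set.Ico 0 (a j)).indicator g t := by
    rw [integral_const_mul, integral_finsetSum _ fun j _ => hint j]
    simp only [hPint]
  have hrhs : ∀ t, 0 ≤ (1 / α) * ∑ j, (Set.Ico 0 (a j)).indicator g t := fun t =>
    mul_nonneg (by positivity)
      (Finset.sum_nonneg fun j _ => Set.indicator_nonneg (fun t _ => hgnonneg t) t)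
  rw [hsum, ← integral_indicator hKmeas]
  refine integral_mono_of_nonneg (Filter.Eventually.of_forall fun t => Set.indicator_nonneg
      (fun t _ => inv_nonneg.mpr (zero_le_one.trans (hN1 t))) t)
    ((integrable_finsetSum _ fun j _ => hint j).const_mul _)
    (Filter.Eventually.of_forall fun t => Set.indicator_le' (fun t ht => ?_)
      (fun t _ => hrhs t) t)
  rw [hKbar] at ht
  obtain ⟨⟨ht0, -⟩, hseq⟩ := ht
  have hcard : ((Finset.univ.filter fun j => t < a j).card : ℝ)
      + ((Finset.univ.filter fun j => a j ≤ t ∧ t < c j).card : ℝ) = N₁ t := by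
    rw [hN₁]
    exact_mod_cast card_parallel_add_card_sequential
      (fun j => by rw [hc]; exact le_add_of_nonneg_right (hQ j)) t
  have hN₁pos : 0 < N₁ t :=
    pos_of_mul_pos_right (lt_of_le_of_lt (Nat.cast_nonneg _) hseq) (by linarith)
  have hNpos : 0 < N t := zero_lt_one.trans_le (hN1 t)
  have hpar : ∑ j, (Set.Ico 0 (a j)).indicator g t
      = ((Finset.univ.filter fun j => t < a j).card : ℝ) * g t := by
    simp [Set.indicator_apply, ht0, Finset.sum_ite]
  calc (N t)⁻¹ = (1 / α) * ((α * N₁ t) * g t) := by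
        simp only [hg]
        field_simp
    _ ≤ (1 / α) * ∑ j, (Set.Ico 0 (a j)).indicator g t := by
        rw [hpar]
        gcongr
        linarith
end

section
/- Consider one set of n₁ ≥ 1 jobs inside an Equi∘Equi execution, encoded as in the context, and let 0 < α < 1. Let K = { t ∈ [0, T) : #{j : a_j ≤ t < c_j} ≥ (1−α)·N₁(t) } (the set of times at which at least a fraction 1−α of the uncompleted jobs of the set are in their sequential phase). Then the Lebesgue measure of K is at most (1 + (Real.log n₁)/(Real.log (1/α))) · max_{j=1..n₁} Q_j. -/
open MeasureTheory

/-- If an antitone counting function `f` is positive on `K` and drops by a factor `α < 1` within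
time `q` after each time of `K`, then the part of `K` after `s` has measure at most
`(1 + log (f s) / log (1 / α)) * q`. -/
theorem volume_inter_Ici_le_of_geometric_decay {f : ℝ → ℕ} (hf : Antitone f) {K : Set ℝ}
    {α q : ℝ} (hα0 : 0 < α) (hα1 : α < 1) (hq : 0 ≤ q) (hpos : ∀ t ∈ K, 1 ≤ f t)
    (hdecay : ∀ t ∈ K, (f (t + q) : ℝ) ≤ α * f t) (s : ℝ) :
    volume (K ∩ Set.Ici s) ≤ ENNReal.ofReal ((1 + Real.log (f s) / Real.log (1 / α)) * q) := by
  induction hm : f s using Nat.strong_induction_on generalizing s with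
  | _ m ih =>
  subst hm
  have hL : 0 < Real.log (1 / α) := Real.log_pos ((one_lt_div hα0).2 hα1)
  rcases (K ∩ Set.Ici s).eq_empty_or_nonempty with hempty | hne
  · simp [hempty]
  have hbdd : BddBelow (K ∩ Set.Ici s) := ⟨s, fun x hx => hx.2⟩
  refine ENNReal.le_of_forall_pos_le_add fun ε hε _ => ?_
  obtain ⟨t, ⟨htK, hst⟩, htε⟩ :=
    exists_lt_of_csInf_lt hne (lt_add_of_pos_right (sInf (K ∩ Set.Ici s)) (NNReal.coe_pos.2 hε))
  have hft : 1 ≤ f t := hpos t htK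
  have hfts : f t ≤ f s := hf hst
  have hfts' : (f t : ℝ) ≤ f s := by exact_mod_cast hfts
  have hft' : (1 : ℝ) ≤ f t := by exact_mod_cast hft
  have hfs' : (1 : ℝ) ≤ f s := hft'.trans hfts'
  have hdec : (f (t + q) : ℝ) ≤ α * f s := (hdecay t htK).trans (by gcongr)
  have hlog : 0 ≤ Real.log (f s) / Real.log (1 / α) := div_nonneg (Real.log_nonneg hfs') hL.le
  have htail : volume (K ∩ Set.Ici (t + q)) ≤
      ENNReal.ofReal (Real.log (f s) / Real.log (1 / α) * q) := by
    rcases Nat.eq_zero_or_pos (f (t + q)) with h0 | h0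
    · have hempty : K ∩ Set.Ici (t + q) = ∅ := by
        refine Set.eq_empty_of_forall_notMem fun x hx => ?_
        have h1 := hpos x hx.1
        have h2 : f x ≤ f (t + q) := hf hx.2
        omega
      simp [hempty]
    · have hlt : f (t + q) < f s := by
        have : (f (t + q) : ℝ) < f s := by nlinarith
        exact_mod_cast this
      refine (ih _ hlt (t + q) rfl).trans (ENNReal.ofReal_le_ofReal ?_)
      refine mul_le_mul_of_nonneg_right ?_ hq
      have hlogle : Real.log (f (t + q)) ≤ Real.log α + Real.log (f s) := by
        rw [← Real.log_mul hα0.ne' (by positivity)]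
        exact Real.log_le_log (by exact_mod_cast h0) hdec
      rw [one_add_div hL.ne']
      refine div_le_div_of_nonneg_right ?_ hL.le
      rw [one_div, Real.log_inv]
      linarith
  have hcover : K ∩ Set.Ici s ⊆
      Set.Ico (sInf (K ∩ Set.Ici s)) (t + q) ∪ (K ∩ Set.Ici (t + q)) := by
    intro x hx
    rcases lt_or_ge x (t + q) with h | h
    · exact Or.inl ⟨csInf_le hbdd hx, h⟩
    · exact Or.inr ⟨hx.1, h⟩
  calc volume (K ∩ Set.Ici s)
      ≤ volume (Set.Ico (sInf (K ∩ Set.Ici s)) (t + q)) + volume (K ∩ Set.Ici (t + q)) :=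
        (measure_mono hcover).trans (measure_union_le _ _)
    _ ≤ ENNReal.ofReal (q + ε) + ENNReal.ofReal (Real.log (f s) / Real.log (1 / α) * q) := by
        rw [Real.volume_Ico]
        exact add_le_add (ENNReal.ofReal_le_ofReal (by linarith)) htail
    _ = ENNReal.ofReal ((1 + Real.log (f s) / Real.log (1 / α)) * q) + ε := by
        rw [← ENNReal.ofReal_coe_nnreal, ← ENNReal.ofReal_add (by positivity) (by positivity),
          ← ENNReal.ofReal_add (by positivity) (by positivity)]
        congr 1
        ring

/-- Sequential-time bound in the key lemma reducing the setflowtime analysis of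
`Equi∘Equi` to the flowtime analysis of `Equi`.  With the same encoding as before, the
Lebesgue measure of the set `K` of times `t ∈ [0, T)` at which at least a fraction
`1 − α` of the uncompleted jobs of the set are in their sequential phase is at most
`(1 + log n₁ / log (1/α)) · max_j Q j`. -/
theorem equi_equi_sequential_bound
    (n₁ : ℕ) (hn₁ : 1 ≤ n₁)
    (P Q a c : Fin n₁ → ℝ) (N : ℝ → ℝ)
    (hNmeas : Measurable N) (hN1 : ∀ t, 1 ≤ N t)
    (hP : ∀ j, 0 ≤ P j) (hQ : ∀ j, 0 ≤ Q j) (ha : ∀ j, 0 ≤ a j)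
    (hc : ∀ j, c j = a j + Q j)
    (N₁ : ℝ → ℝ)
    (hN₁ : ∀ t, N₁ t = ((Finset.univ.filter fun j => t < c j).card : ℝ))
    (hwork : ∀ j, (∫ t in (0:ℝ)..(a j), (N t * N₁ t)⁻¹) = P j)
    (T : ℝ) (hT : T = Finset.univ.sup' ⟨⟨0, hn₁⟩, Finset.mem_univ _⟩ c)
    (α : ℝ) (hα0 : 0 < α) (hα1 : α < 1)
    (K : Set ℝ)
    (hK : K = {t : ℝ | t ∈ Set.Ico 0 T ∧
      (1 - α) * N₁ t ≤ ((Finset.univ.filter fun j => a j ≤ t ∧ t < c j).card : ℝ)}) :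
    volume K ≤ ENNReal.ofReal
      ((1 + Real.log n₁ / Real.log (1 / α)) *
        Finset.univ.sup' ⟨⟨0, hn₁⟩, Finset.mem_univ _⟩ Q) := by
  have hne : (Finset.univ : Finset (Fin n₁)).Nonempty := ⟨⟨0, hn₁⟩, Finset.mem_univ _⟩
  set q := Finset.univ.sup' hne Q
  have hQq : ∀ j, Q j ≤ q := fun j => Finset.le_sup' Q (Finset.mem_univ j)
  have hq : 0 ≤ q := (hQ ⟨0, hn₁⟩).trans (hQq _)
  let f : ℝ → ℕ := fun t => (Finset.univ.filter fun j => t < c j).card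
  have hf : Antitone f := fun s t hst =>
    Finset.card_le_card (Finset.monotone_filter_right _ fun j _ hj => hst.trans_lt hj)
  have hpos : ∀ t ∈ K, 1 ≤ f t := by
    intro t ht
    rw [hK, hT] at ht
    obtain ⟨j, -, hj⟩ := (Finset.lt_sup'_iff hne).1 ht.1.2
    exact Finset.card_pos.2 ⟨j, by simpa using hj⟩
  have hdecay : ∀ t ∈ K, (f (t + q) : ℝ) ≤ α * f t := by
    intro t ht
    rw [hK] at ht
    have hseq := ht.2
    rw [hN₁] at hseq
    have hcard : f (t + q) + (Finset.univ.filter fun j => a j ≤ t ∧ t < c j).card ≤ f t := by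
      rw [← Finset.card_union_of_disjoint]
      · refine Finset.card_le_card fun j hj => ?_
        simp only [Finset.mem_union, Finset.mem_filter, Finset.mem_univ, true_and] at hj ⊢
        rcases hj with hj | hj
        · linarith
        · exact hj.2
      · refine Finset.disjoint_filter.2 fun j _ hj hj' => ?_
        linarith [hc j, hQq j, hj'.1]
    have hcard' : (f (t + q) : ℝ) +
        ((Finset.univ.filter fun j => a j ≤ t ∧ t < c j).card : ℝ) ≤ f t := by
      exact_mod_cast hcard
    change (1 - α) * (f t : ℝ) ≤ _ at hseq
    linarith
  have hK0 : K ⊆ K ∩ Set.Ici 0 := by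
    refine fun t ht => ⟨ht, ?_⟩
    rw [hK] at ht
    exact ht.1.1
  refine (measure_mono hK0).trans ((volume_inter_Ici_le_of_geometric_decay hf hα0 hα1 hq hpos
    hdecay 0).trans (ENNReal.ofReal_le_ofReal ?_))
  have hL : 0 < Real.log (1 / α) := Real.log_pos ((one_lt_div hα0).2 hα1)
  have hfn : f 0 ≤ n₁ := (Finset.card_le_univ _).trans_eq (Fintype.card_fin n₁)
  have hlog : Real.log (f 0) ≤ Real.log n₁ := by
    rcases Nat.eq_zero_or_pos (f 0) with h0 | h0
    · rw [h0, Nat.cast_zero, Real.log_zero]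
      exact Real.log_natCast_nonneg n₁
    · exact Real.log_le_log (by exact_mod_cast h0) (by exact_mod_cast hfn)
  gcongr
end

section
/- Let J be a job consisting of q phases, where phase k has work w_k > 0 and speed-up function Γ_k : [0,∞) → [0,∞) that is nondecreasing, sublinear (for all 0 < ρ ≤ ρ', Γ_k(ρ)/ρ ≥ Γ_k(ρ')/ρ'), and positive on (0,∞). Let ρ_A, ρ_O : [0,∞) → [0,∞) be piecewise-constant allocation functions with ρ_A(t) > 0 for all t. Execution of a phased job under an allocation ρ is defined by: phase k runs from the completion time t_{k−1} of phase k−1 (with t_0 = 0) until the first time t_k at which ∫_{t_{k−1}}^{t_k} Γ_k(ρ(u)) du ≥ w_k. Assume J completes in finite time under both allocations, at times T_A under ρ_A and T_O under ρ_O. Then there exists a (Par-Seq)* job J'—a finite sequence of phases, each either sequential (speed-up function constantly equal to 1, so it progresses at rate 1 regardless of the allocation) or fully parallel (speed-up function Γ(ρ) = ρ), with nonnegative works—such that J' completes at time exactly T_A under the allocation ρ_A and completes at a time at most T_O under the allocation ρ_O. -/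
open MeasureTheory

/-- A function `f : ℝ → ℝ` is piecewise constant if there is a jump set `D` that is
finite on every compact interval and `f` is constant on every interval avoiding `D`. -/
def PiecewiseConstant (f : ℝ → ℝ) : Prop :=
  ∃ D : Set ℝ, (∀ a b : ℝ, (D ∩ Set.Icc a b).Finite) ∧
    ∀ x y : ℝ, x ≤ y → Set.Icc x y ∩ D = ∅ → f x = f y

/-- `Runs ρ t J T` : the phased job `J` (a list of pairs `(w, Γ)` of a work and a
speed-up function), started at time `t` under the allocation `ρ`, completes exactly at
time `T`; each phase `(w, Γ)` started at time `t` ends at the first time `x ≥ t` at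
which `∫_t^x Γ (ρ u) du ≥ w`. -/
def Runs (ρ : ℝ → ℝ) : ℝ → List (ℝ × (ℝ → ℝ)) → ℝ → Prop
  | t, [], T => T = t
  | t, (w, Γ) :: L, T =>
      {x : ℝ | t ≤ x ∧ w ≤ ∫ u in t..x, Γ (ρ u)}.Nonempty ∧
      Runs ρ (sInf {x : ℝ | t ≤ x ∧ w ≤ ∫ u in t..x, Γ (ρ u)}) L T

namespace ParSeqReduction

/-- `D` is a locally finite set containing all jumps of `f`. -/
def IsJumpSet (D : Set ℝ) (f : ℝ → ℝ) : Prop :=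
  (∀ a b : ℝ, (D ∩ Set.Icc a b).Finite) ∧
    ∀ x y : ℝ, x ≤ y → Set.Icc x y ∩ D = ∅ → f x = f y

namespace IsJumpSet

variable {D : Set ℝ} {f : ℝ → ℝ} {a b a' b' x : ℝ}

theorem finite_Ioo (h : IsJumpSet D f) (a b : ℝ) : (D ∩ Set.Ioo a b).Finite :=
  (h.1 a b).subset (Set.inter_subset_inter_right _ Set.Ioo_subset_Icc_self)

theorem exists_eqOn_const (h : IsJumpSet D f) (he : D ∩ Set.Ioo a b = ∅) :
    ∃ t, Set.EqOn f (fun _ => f t) (Set.Ioo a b) := by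
  have key : ∀ x ∈ Set.Ioo a b, ∀ y ∈ Set.Ioo a b, x ≤ y → f x = f y := by
    intro x hx y hy hxy
    refine h.2 x y hxy (Set.eq_empty_of_forall_notMem ?_)
    rintro z ⟨hz, hzD⟩
    exact Set.eq_empty_iff_forall_notMem.1 he z
      ⟨hzD, hx.1.trans_le hz.1, hz.2.trans_lt hy.2⟩
  rcases (Set.Ioo a b).eq_empty_or_nonempty with h0 | ⟨t, ht⟩
  · exact ⟨0, by simp [h0]⟩
  · refine ⟨t, fun u hu => ?_⟩
    rcases le_total t u with htu | htu
    · exact (key t ht u hu htu).symm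
    · exact key u hu t ht htu

theorem ncard_le (h : IsJumpSet D f) (ha : a ≤ a') (hb : b' ≤ b) :
    (D ∩ Set.Ioo a' b').ncard ≤ (D ∩ Set.Ioo a b).ncard :=
  Set.ncard_le_ncard (Set.inter_subset_inter_right _ (Set.Ioo_subset_Ioo ha hb))
    (h.finite_Ioo a b)

theorem ncard_lt (h : IsJumpSet D f) (ha : a ≤ a') (hb : b' ≤ b)
    (hx : x ∈ D ∩ Set.Ioo a b) (hx' : x ∉ Set.Ioo a' b') :
    (D ∩ Set.Ioo a' b').ncard < (D ∩ Set.Ioo a b).ncard :=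
  Set.ncard_lt_ncard ⟨Set.inter_subset_inter_right _ (Set.Ioo_subset_Ioo ha hb),
    fun hsub => hx' (hsub hx).2⟩ (h.finite_Ioo a b)

theorem intervalIntegrable_comp (h : IsJumpSet D f) (g : ℝ → ℝ) (a b : ℝ) :
    IntervalIntegrable (fun u => g (f u)) volume a b := by
  have key : ∀ n : ℕ, ∀ a b : ℝ, a ≤ b → (D ∩ Set.Ioo a b).ncard = n →
      IntervalIntegrable (fun u => g (f u)) volume a b := by
    intro n
    induction n using Nat.strong_induction_on with
    | _ n ih =>
      intro a b hab hn
      rcases (D ∩ Set.Ioo a b).eq_empty_or_nonempty with he | ⟨x, hx⟩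
      · obtain ⟨t, ht⟩ := h.exists_eqOn_const he
        refine (intervalIntegrable_const (c := g (f t))).congr_uIoo ?_
        rw [Set.uIoo_of_le hab]
        exact fun u hu => by simp [ht hu]
      · exact (ih _ (hn ▸ h.ncard_lt le_rfl hx.2.2.le hx (by simp)) a x hx.2.1.le rfl).trans
          (ih _ (hn ▸ h.ncard_lt hx.2.1.le le_rfl hx (by simp)) x b hx.2.2.le rfl)
  rcases le_total a b with hab | hab
  · exact key _ a b hab rfl
  · exact (key _ b a hab rfl).symm

end IsJumpSet

section Primitive

variable {f : ℝ → ℝ} {a b c : ℝ}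

theorem exists_integral_eq (hf : ∀ a b, IntervalIntegrable f volume a b) (hab : a ≤ b)
    (hc0 : 0 ≤ c) (hc : c ≤ ∫ u in a..b, f u) :
    ∃ x ∈ Set.Icc a b, ∫ u in a..x, f u = c :=
  intermediate_value_Icc hab (intervalIntegral.continuous_primitive hf a).continuousOn
    ⟨by simpa using hc0, hc⟩

theorem integral_sInf_eq {w t : ℝ} (hf : ∀ a b, IntervalIntegrable f volume a b) (hw : 0 ≤ w)
    (hne : {x : ℝ | t ≤ x ∧ w ≤ ∫ u in t..x, f u}.Nonempty) :
    t ≤ sInf {x : ℝ | t ≤ x ∧ w ≤ ∫ u in t..x, f u} ∧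
      ∫ u in t..sInf {x : ℝ | t ≤ x ∧ w ≤ ∫ u in t..x, f u}, f u = w := by
  have hbdd : BddBelow {x : ℝ | t ≤ x ∧ w ≤ ∫ u in t..x, f u} := ⟨t, fun x hx => hx.1⟩
  have hclosed : IsClosed {x : ℝ | t ≤ x ∧ w ≤ ∫ u in t..x, f u} :=
    isClosed_Ici.inter
      (isClosed_le continuous_const (intervalIntegral.continuous_primitive hf t))
  obtain ⟨h1, h2⟩ := hclosed.csInf_mem hne hbdd
  obtain ⟨y, hy, hyw⟩ := exists_integral_eq hf h1 hw h2
  have hle := csInf_le hbdd (show y ∈ _ from ⟨hy.1, hyw.ge⟩)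
  rw [le_antisymm hle hy.2]
  exact ⟨hy.1, hyw⟩

theorem sInf_eq_of_pos {w : ℝ} (hf : ∀ a b, IntervalIntegrable f volume a b)
    (hpos : ∀ u, 0 < f u) (hab : a ≤ b) (hw : ∫ u in a..b, f u = w) :
    sInf {x : ℝ | a ≤ x ∧ w ≤ ∫ u in a..x, f u} = b := by
  refine IsLeast.csInf_eq ⟨⟨hab, hw.ge⟩, fun x hx => ?_⟩
  by_contra! hlt
  have h1 := intervalIntegral.intervalIntegral_pos_of_pos (hf x b) hpos hlt
  have h2 := intervalIntegral.integral_add_adjacent_intervals (hf a x) (hf x b)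
  linarith [hx.2]

end Primitive

/-- Every phase of the job is sequential or fully parallel, with nonnegative work. -/
def IsParSeq (J : List (ℝ × (ℝ → ℝ))) : Prop :=
  ∀ p ∈ J, 0 ≤ p.1 ∧ ((p.2 = fun _ => (1 : ℝ)) ∨ p.2 = fun r => r)

section Runs

variable {ρ : ℝ → ℝ} {J J' : List (ℝ × (ℝ → ℝ))} {s t T : ℝ}

theorem runs_append (h : Runs ρ t J s) (h' : Runs ρ s J' T) : Runs ρ t (J ++ J') T := by
  induction J generalizing t with
  | nil => simp only [Runs] at h; subst h; exact h'
  | cons p J ih => exact ⟨h.1, ih h.2⟩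

theorem exists_runs_of_le (hint : ∀ g : ℝ → ℝ, ∀ a b,
      IntervalIntegrable (fun u => g (ρ u)) volume a b)
    (hJ : ∀ p ∈ J, ∀ u, 0 ≤ p.2 (ρ u)) (hst : s ≤ t) (h : Runs ρ t J T) :
    ∃ T' ≤ T, Runs ρ s J T' := by
  induction J generalizing s t with
  | nil => simp only [Runs] at h; subst h; exact ⟨s, hst, rfl⟩
  | cons p J ih =>
    obtain ⟨w, Γ⟩ := p
    obtain ⟨hne, hrun⟩ := h
    have hsub : {x : ℝ | t ≤ x ∧ w ≤ ∫ u in t..x, Γ (ρ u)} ⊆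
        {x : ℝ | s ≤ x ∧ w ≤ ∫ u in s..x, Γ (ρ u)} := by
      rintro x ⟨h1, h2⟩
      refine ⟨hst.trans h1, ?_⟩
      rw [← intervalIntegral.integral_add_adjacent_intervals (hint Γ s t) (hint Γ t x)]
      have := intervalIntegral.integral_nonneg (μ := volume) hst
        fun u _ => hJ (w, Γ) List.mem_cons_self u
      simp only at this
      linarith
    obtain ⟨T', hT', hr⟩ := ih (fun p hp => hJ p (List.mem_cons_of_mem _ hp))
      (csInf_le_csInf ⟨s, fun x hx => hx.1⟩ hne hsub) hrun
    exact ⟨T', hT', hne.mono hsub, hr⟩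

end Runs

/-- Some `(Par-Seq)*` job runs exactly from `a` to `a'` under `ρA`, and, started at `o` under `ρO`,
completes by time `o'`. -/
def Fits (ρA ρO : ℝ → ℝ) (a o a' o' : ℝ) : Prop :=
  ∃ J, IsParSeq J ∧ Runs ρA a J a' ∧ ∃ T ≤ o', Runs ρO o J T

section Fits

variable {ρA ρO : ℝ → ℝ} {a o a' o' a'' o'' : ℝ}

theorem Fits.refl (a : ℝ) (h : o ≤ o') : Fits ρA ρO a o a o' :=
  ⟨[], by simp [IsParSeq], rfl, o, h, rfl⟩

theorem Fits.trans {DO : Set ℝ} (hDO : IsJumpSet DO ρO) (hO : ∀ t, 0 ≤ ρO t)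
    (h : Fits ρA ρO a o a' o') (h' : Fits ρA ρO a' o' a'' o'') : Fits ρA ρO a o a'' o'' := by
  obtain ⟨J, hJ, hA, T, hT, hTO⟩ := h
  obtain ⟨J', hJ', hA', T', hT', hTO'⟩ := h'
  have hnn : ∀ p ∈ J', ∀ u, 0 ≤ p.2 (ρO u) := by
    intro p hp u
    rcases (hJ' p hp).2 with h | h <;> simp [h, hO u]
  obtain ⟨T'', hle, hr⟩ := exists_runs_of_le hDO.intervalIntegrable_comp hnn hT hTO'
  refine ⟨J ++ J', ?_, runs_append hA hA', T'', hle.trans hT', runs_append hTO hr⟩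
  intro p hp
  exact (List.mem_append.1 hp).elim (hJ p) (hJ' p)

/-- A single phase whose work is exactly done on `[a, a']` under `ρA` and is at most what is done
on `[o, o']` under `ρO`. -/
theorem Fits.of_phase {DA : Set ℝ} (hDA : IsJumpSet DA ρA) {Γ : ℝ → ℝ}
    (hΓ : (Γ = fun _ => (1 : ℝ)) ∨ Γ = fun r => r) (hA : ∀ t, 0 < ρA t)
    (ha : a ≤ a') (ho : o ≤ o')
    (h : ∫ u in a..a', Γ (ρA u) ≤ ∫ u in o..o', Γ (ρO u)) : Fits ρA ρO a o a' o' := by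
  have hpos : ∀ u, 0 < Γ (ρA u) := by rcases hΓ with rfl | rfl <;> simp [hA]
  refine ⟨[(∫ u in a..a', Γ (ρA u), Γ)], ?_, ⟨⟨a', ha, le_rfl⟩, ?_⟩, _, ?_, ⟨⟨o', ho, h⟩, rfl⟩⟩
  · intro p hp
    obtain rfl := List.mem_singleton.1 hp
    exact ⟨intervalIntegral.integral_nonneg ha fun u _ => (hpos u).le, hΓ⟩
  · exact (sInf_eq_of_pos (hDA.intervalIntegrable_comp Γ) hpos ha rfl).symm
  · exact csInf_le ⟨o, fun x hx => hx.1⟩ ⟨ho, h⟩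

theorem integral_comp_eq_of_eqOn {ρ : ℝ → ℝ} {c : ℝ} (g : ℝ → ℝ) (hab : a ≤ a')
    (h : Set.EqOn ρ (fun _ => c) (Set.Ioo a a')) :
    ∫ u in a..a', g (ρ u) = (a' - a) * g c := by
  rw [intervalIntegral.integral_congr_Ioo_of_le hab (g := fun _ => g c)
    fun u hu => congrArg g (h hu)]
  simp

variable {DA DO : Set ℝ} {Γ : ℝ → ℝ}

/-- The reduction for a part of a phase during which both allocations are constant. -/
theorem Fits.of_const (hDA : IsJumpSet DA ρA) (hA : ∀ t, 0 < ρA t)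
    (hmono : Monotone Γ)
    (hsub : ∀ r r' : ℝ, 0 < r → r ≤ r' → Γ r' / r' ≤ Γ r / r)
    (hpos : ∀ r : ℝ, 0 < r → 0 < Γ r) {c d : ℝ} (hc0 : 0 < c)
    (ha : a ≤ a') (ho : o ≤ o')
    (hc : Set.EqOn ρA (fun _ => c) (Set.Ioo a a')) (hd : Set.EqOn ρO (fun _ => d) (Set.Ioo o o'))
    (h : ∫ u in a..a', Γ (ρA u) = ∫ u in o..o', Γ (ρO u)) : Fits ρA ρO a o a' o' := by
  rw [integral_comp_eq_of_eqOn Γ ha hc, integral_comp_eq_of_eqOn Γ ho hd] at h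
  have hΓc := hpos c hc0
  rcases le_or_gt d c with hdc | hcd
  · refine Fits.of_phase hDA (Or.inl rfl) hA ha ho ?_
    simp only [intervalIntegral.integral_const, smul_eq_mul, mul_one]
    refine le_of_mul_le_mul_right ?_ hΓc
    rw [h]
    exact mul_le_mul_of_nonneg_left (hmono hdc) (sub_nonneg.2 ho)
  · refine Fits.of_phase hDA (Or.inr rfl) hA ha ho ?_
    rw [integral_comp_eq_of_eqOn (fun r => r) ha hc, integral_comp_eq_of_eqOn (fun r => r) ho hd]
    have hs := hsub c d hc0 hcd.le
    rw [div_le_div_iff₀ (hc0.trans hcd) hc0] at hs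
    refine le_of_mul_le_mul_right ?_ hΓc
    calc (a' - a) * c * Γ c = (a' - a) * Γ c * c := by ring
      _ = (o' - o) * (Γ d * c) := by rw [h]; ring
      _ ≤ (o' - o) * (Γ c * d) := mul_le_mul_of_nonneg_left hs (sub_nonneg.2 ho)
      _ = (o' - o) * d * Γ c := by ring

/-- The reduction for any part of a phase, by induction on the number of jumps of the two
allocations. -/
theorem Fits.of_integral_eq (hDA : IsJumpSet DA ρA) (hDO : IsJumpSet DO ρO)
    (hA : ∀ t, 0 < ρA t) (hO : ∀ t, 0 ≤ ρO t) (hmono : Monotone Γ)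
    (hnn : ∀ r : ℝ, 0 ≤ r → 0 ≤ Γ r)
    (hsub : ∀ r r' : ℝ, 0 < r → r ≤ r' → Γ r' / r' ≤ Γ r / r)
    (hpos : ∀ r : ℝ, 0 < r → 0 < Γ r) (ha : a ≤ a') (ho : o ≤ o')
    (h : ∫ u in a..a', Γ (ρA u) = ∫ u in o..o', Γ (ρO u)) : Fits ρA ρO a o a' o' := by
  have hintA := hDA.intervalIntegrable_comp Γ
  have hintO := hDO.intervalIntegrable_comp Γ
  have hnA : ∀ {x y : ℝ}, x ≤ y → 0 ≤ ∫ u in x..y, Γ (ρA u) := fun hxy =>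
    intervalIntegral.integral_nonneg hxy fun u _ => hnn _ (hA u).le
  have hnO : ∀ {x y : ℝ}, x ≤ y → 0 ≤ ∫ u in x..y, Γ (ρO u) := fun hxy =>
    intervalIntegral.integral_nonneg hxy fun u _ => hnn _ (hO u)
  induction hn : (DA ∩ Set.Ioo a a').ncard + (DO ∩ Set.Ioo o o').ncard
    using Nat.strong_induction_on generalizing a a' o o' with
  | _ n ih =>
    have split : ∀ x ∈ Set.Icc a a', ∀ y ∈ Set.Icc o o',
        ∫ u in a..x, Γ (ρA u) = ∫ u in o..y, Γ (ρO u) →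
        (x ∈ DA ∩ Set.Ioo a a' ∨ y ∈ DO ∩ Set.Ioo o o') → Fits ρA ρO a o a' o' := by
      intro x hx y hy hxy hj
      have h1 := intervalIntegral.integral_add_adjacent_intervals (hintA a x) (hintA x a')
      have h2 := intervalIntegral.integral_add_adjacent_intervals (hintO o y) (hintO y o')
      have lA := hDA.ncard_le le_rfl hx.2 (a := a)
      have rA := hDA.ncard_le hx.1 le_rfl (b := a')
      have lO := hDO.ncard_le le_rfl hy.2 (a := o)
      have rO := hDO.ncard_le hy.1 le_rfl (b := o')
      have hcard : (DA ∩ Set.Ioo a x).ncard + (DO ∩ Set.Ioo o y).ncard < n ∧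
          (DA ∩ Set.Ioo x a').ncard + (DO ∩ Set.Ioo y o').ncard < n := by
        rcases hj with hj | hj
        · have := hDA.ncard_lt le_rfl hx.2 hj (by simp)
          have := hDA.ncard_lt hx.1 le_rfl hj (by simp)
          omega
        · have := hDO.ncard_lt le_rfl hy.2 hj (by simp)
          have := hDO.ncard_lt hy.1 le_rfl hj (by simp)
          omega
      exact (ih _ hcard.1 hx.1 hy.1 hxy rfl).trans hDO hO
        (ih _ hcard.2 hx.2 hy.2 (by linarith) rfl)
    rcases (DA ∩ Set.Ioo a a').eq_empty_or_nonempty with heA | ⟨x, hx⟩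
    · rcases (DO ∩ Set.Ioo o o').eq_empty_or_nonempty with heO | ⟨y, hy⟩
      · obtain ⟨s, hs⟩ := hDA.exists_eqOn_const heA
        obtain ⟨t, ht⟩ := hDO.exists_eqOn_const heO
        exact Fits.of_const hDA hA hmono hsub hpos (hA s) ha ho hs ht h
      · have hadd := intervalIntegral.integral_add_adjacent_intervals (hintO o y) (hintO y o')
        obtain ⟨x, hx, hxy⟩ := exists_integral_eq hintA ha (hnO hy.2.1.le)
          (by linarith [hnO hy.2.2.le])
        exact split x hx y (Set.Ioo_subset_Icc_self hy.2) hxy (Or.inr hy)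
    · have hadd := intervalIntegral.integral_add_adjacent_intervals (hintA a x) (hintA x a')
      obtain ⟨y, hy, hxy⟩ := exists_integral_eq hintO ho (hnA hx.2.1.le)
        (by linarith [hnA hx.2.2.le])
      exact split x (Set.Ioo_subset_Icc_self hx.2) y hy hxy.symm (Or.inl hx)

theorem Fits.of_runs (hDA : IsJumpSet DA ρA) (hDO : IsJumpSet DO ρO)
    (hA : ∀ t, 0 < ρA t) (hO : ∀ t, 0 ≤ ρO t) {J : List (ℝ × (ℝ → ℝ))}
    (hJ : ∀ p ∈ J, 0 < p.1 ∧ Monotone p.2 ∧ (∀ r : ℝ, 0 ≤ r → 0 ≤ p.2 r) ∧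
      (∀ r r' : ℝ, 0 < r → r ≤ r' → p.2 r' / r' ≤ p.2 r / r) ∧ ∀ r : ℝ, 0 < r → 0 < p.2 r)
    (hrA : Runs ρA a J a') (hrO : Runs ρO o J o') : Fits ρA ρO a o a' o' := by
  induction J generalizing a o with
  | nil =>
    simp only [Runs] at hrA hrO
    subst hrA hrO
    exact Fits.refl _ le_rfl
  | cons p J ih =>
    obtain ⟨w, Γ⟩ := p
    obtain ⟨hw, hmono, hnn, hsub, hpos⟩ := hJ (w, Γ) List.mem_cons_self
    obtain ⟨ha, hwA⟩ := integral_sInf_eq (hDA.intervalIntegrable_comp Γ) hw.le hrA.1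
    obtain ⟨ho, hwO⟩ := integral_sInf_eq (hDO.intervalIntegrable_comp Γ) hw.le hrO.1
    exact (Fits.of_integral_eq hDA hDO hA hO hmono hnn hsub hpos ha ho
      (hwA.trans hwO.symm)).trans hDO hO
      (ih (fun p hp => hJ p (List.mem_cons_of_mem _ hp)) hrA.2 hrO.2)

end Fits

end ParSeqReduction

/-- Per-job reduction to `(Par-Seq)*` jobs (Edmonds' reduction, Lemma 1 of the paper):
given a job with `q` phases of positive works `w k` and nondecreasing, sublinear speed-up
functions `Γ k` that are nonnegative and positive on `(0,∞)`, and two piecewise-constant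
nonnegative allocations `ρA` (everywhere positive) and `ρO` under which the job completes
at times `TA` and `TO` respectively, there is a job `J'` all of whose phases are either
sequential (`Γ = 1`) or fully parallel (`Γ = id`) with nonnegative works, such that `J'`
completes exactly at time `TA` under `ρA` and at a time at most `TO` under `ρO`. -/
theorem reduction_to_parseq_star
    (q : ℕ) (w : Fin q → ℝ) (Γ : Fin q → ℝ → ℝ)
    (hw : ∀ k, 0 < w k)
    (hΓmono : ∀ k, Monotone (Γ k))
    (hΓ0 : ∀ k, ∀ r : ℝ, 0 ≤ r → 0 ≤ Γ k r)
    (hΓsub : ∀ k, ∀ r r' : ℝ, 0 < r → r ≤ r' → Γ k r' / r' ≤ Γ k r / r)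
    (hΓpos : ∀ k, ∀ r : ℝ, 0 < r → 0 < Γ k r)
    (ρA ρO : ℝ → ℝ)
    (hApos : ∀ t, 0 < ρA t) (hOnonneg : ∀ t, 0 ≤ ρO t)
    (hApc : PiecewiseConstant ρA) (hOpc : PiecewiseConstant ρO)
    (TA TO : ℝ)
    (hTA : Runs ρA 0 (List.ofFn fun k => (w k, Γ k)) TA)
    (hTO : Runs ρO 0 (List.ofFn fun k => (w k, Γ k)) TO) :
    ∃ J' : List (ℝ × (ℝ → ℝ)),
      (∀ p ∈ J', 0 ≤ p.1 ∧ ((p.2 = fun _ => (1:ℝ)) ∨ p.2 = fun r => r)) ∧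
      Runs ρA 0 J' TA ∧
      ∃ T' : ℝ, T' ≤ TO ∧ Runs ρO 0 J' T' := by
  obtain ⟨DA, hDA⟩ := hApc
  obtain ⟨DO, hDO⟩ := hOpc
  refine ParSeqReduction.Fits.of_runs hDA hDO hApos hOnonneg (fun p hp => ?_) hTA hTO
  obtain ⟨k, rfl⟩ := (List.mem_ofFn' _ _).1 hp
  exact ⟨hw k, hΓmono k, hΓ0 k, hΓsub k, hΓpos k⟩
end
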